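/- For all γ₁, γ₂ ∈ Γ₀(q₁q₂), the newform Dedekind sum satisfies the crossed homomorphism identity S_{χ₁,χ₂}(γ₁γ₂) = S_{χ₁,χ₂}(γ₁) + ψ(γ₁)·S_{χ₁,χ₂}(γ₂). -/

import Mathlib

open scoped MatrixGroups
open CongruenceSubgroup Matrix

/-- The first Bernoulli function `B₁(x)`: equal to `x - ⌊x⌋ - 1/2` for non-integral `x`
and `0` for integral `x`. -/
noncomputable def B1 (x : ℝ) : ℝ := if Int.fract x = 0 then 0 else Int.fract x - 1/2

/-- The newform Dedekind sum `S_{χ₁,χ₂}(a, c)`. -/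
noncomputable def ded {q₁ q₂ : ℕ} (χ₁ : DirichletCharacter ℂ q₁)
    (χ₂ : DirichletCharacter ℂ q₂) (a c : ℤ) : ℂ :=
  ∑ j ∈ Finset.range c.toNat, ∑ n ∈ Finset.range q₁,
    (starRingEnd ℂ) (χ₂ (j : ZMod q₂)) * (starRingEnd ℂ) (χ₁ (n : ZMod q₁)) *
      ((B1 ((j : ℝ) / (c : ℝ)) * B1 ((n : ℝ) / (q₁ : ℝ) + (a : ℝ) * (j : ℝ) / (c : ℝ)) : ℝ) : ℂ)

/-- The newform Dedekind sum `S_{χ₁,χ₂}(γ)` of a matrix `γ`. -/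
noncomputable def dedSL {q₁ q₂ : ℕ} (χ₁ : DirichletCharacter ℂ q₁)
    (χ₂ : DirichletCharacter ℂ q₂) (γ : SL(2, ℤ)) : ℂ :=
  if 0 < (γ : Matrix (Fin 2) (Fin 2) ℤ) 1 0 then
    ded χ₁ χ₂ ((γ : Matrix (Fin 2) (Fin 2) ℤ) 0 0) ((γ : Matrix (Fin 2) (Fin 2) ℤ) 1 0)
  else if (γ : Matrix (Fin 2) (Fin 2) ℤ) 1 0 < 0 then
    ded χ₁ χ₂ (-(γ : Matrix (Fin 2) (Fin 2) ℤ) 0 0) (-(γ : Matrix (Fin 2) (Fin 2) ℤ) 1 0)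
  else 0

/-- The character `ψ = χ₁ · χ̄₂` modulo `q₁ q₂`. -/
noncomputable def psiChar {q₁ q₂ : ℕ} (χ₁ : DirichletCharacter ℂ q₁)
    (χ₂ : DirichletCharacter ℂ q₂) : DirichletCharacter ℂ (q₁ * q₂) :=
  DirichletCharacter.changeLevel ⟨q₂, rfl⟩ χ₁ *
    DirichletCharacter.changeLevel ⟨q₁, mul_comm q₁ q₂⟩ (χ₂.ringHomComp (starRingEnd ℂ))


lemma B1_add_int (x : ℝ) (n : ℤ) : B1 (x + n) = B1 x := by
  unfold B1; simp only [Int.fract_add_intCast]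

lemma B1_neg (x : ℝ) : B1 (-x) = -B1 x := by
  unfold B1
  by_cases h : Int.fract x = 0
  · rw [if_pos h, if_pos (Int.fract_neg_eq_zero.2 h)]; simp
  · rw [if_neg h, if_neg (fun h' => h (Int.fract_neg_eq_zero.1 h')), Int.fract_neg h]; ring

/-- second Bernoulli function -/
noncomputable def B2f (x : ℝ) : ℝ := Int.fract x ^ 2 - Int.fract x + 1/6

lemma B2f_add_int (x : ℝ) (n : ℤ) : B2f (x + n) = B2f x := by
  unfold B2f; simp only [Int.fract_add_intCast]

lemma div_congr_aux {n k k' : ℤ} (h : n ∣ k' - k) :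
    ∃ m : ℤ, ((k' : ℝ) / n) = (k : ℝ) / n + m := by
  obtain ⟨m, hm⟩ := h
  by_cases hn : n = 0
  · subst hn
    exact ⟨0, by simp⟩
  · refine ⟨m, ?_⟩
    have : (n : ℝ) ≠ 0 := by exact_mod_cast hn
    have h2 : (k' : ℝ) = k + n * m := by
      have : k' = k + n * m := by linarith
      exact_mod_cast this
    rw [h2]; field_simp

lemma B1_div_congr {n k k' : ℤ} (h : n ∣ k' - k) : B1 ((k' : ℝ) / n) = B1 ((k : ℝ) / n) := by
  obtain ⟨m, hm⟩ := div_congr_aux h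
  rw [hm, B1_add_int]

lemma B2f_div_congr {n k k' : ℤ} (h : n ∣ k' - k) : B2f ((k' : ℝ) / n) = B2f ((k : ℝ) / n) := by
  obtain ⟨m, hm⟩ := div_congr_aux h
  rw [hm, B2f_add_int]

lemma B1_three (x y z : ℝ) (h : x + y + z = 0) (hne : ¬ (Int.fract x = 0 ∧ Int.fract y = 0)) :
    B1 x * B1 y + B1 y * B1 z + B1 z * B1 x = -(1/2) * (B2f x + B2f y + B2f z) := by
  have hs : ∃ n : ℤ, Int.fract x + Int.fract y + Int.fract z = n :=
    ⟨-⌊x⌋ - ⌊y⌋ - ⌊z⌋, by push_cast; unfold Int.fract; linarith⟩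
  obtain ⟨n, hn⟩ := hs
  have hx0 := Int.fract_nonneg x
  have hx1 := Int.fract_lt_one x
  have hy0 := Int.fract_nonneg y
  have hy1 := Int.fract_lt_one y
  have hz0 := Int.fract_nonneg z
  have hz1 := Int.fract_lt_one z
  unfold B1 B2f
  generalize Int.fract x = u at *
  generalize Int.fract y = v at *
  generalize Int.fract z = w at *
  have hn3 : n < 3 := by
    have : (n : ℝ) < 3 := by linarith
    exact_mod_cast this
  have hn0 : 0 < n := by
    have : (0 : ℝ) < n := by
      rcases lt_or_eq_of_le hx0 with h1 | h1
      · linarith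
      · rcases lt_or_eq_of_le hy0 with h2 | h2
        · linarith
        · exact absurd ⟨h1.symm, h2.symm⟩ hne
    exact_mod_cast this
  have hw : w = n - u - v := by linarith
  by_cases hu : u = 0
  · have hv : v ≠ 0 := fun hv => hne ⟨hu, hv⟩
    have hn1 : n = 1 := by
      have : (n : ℝ) < 2 := by linarith
      have : n < 2 := by exact_mod_cast this
      omega
    subst hn1
    have hw0 : w ≠ 0 := by push_cast at hw; intro h0; linarith
    rw [if_pos hu, if_neg hv, if_neg hw0, hw, hu]; push_cast; ring
  · by_cases hv : v = 0
    · have hn1 : n = 1 := by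
        have : (n : ℝ) < 2 := by linarith
        have : n < 2 := by exact_mod_cast this
        omega
      subst hn1
      have hw0 : w ≠ 0 := by push_cast at hw; intro h0; linarith
      rw [if_neg hu, if_pos hv, if_neg hw0, hw, hv]; push_cast; ring
    · rw [if_neg hu, if_neg hv]
      by_cases hw0 : w = 0
      · have hn1 : n = 1 := by
          have : (n : ℝ) < 2 := by linarith
          have : n < 2 := by exact_mod_cast this
          omega
        subst hn1
        rw [if_pos hw0]
        have : u = 1 - v := by push_cast at hw; linarith
        rw [hw0, this]; ring
      · rw [if_neg hw0, hw]
        have : n = 1 ∨ n = 2 := by omega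
        rcases this with h | h <;> subst h <;> push_cast <;> ring

lemma sum_range_cast_id (N : ℕ) : ∑ k ∈ Finset.range N, (k : ℝ) = (N : ℝ) * (N - 1) / 2 := by
  induction N with
  | zero => simp
  | succ n ih => rw [Finset.sum_range_succ, ih]; push_cast; ring

lemma B1_distrib (N : ℕ) (hN : 0 < N) (x : ℝ) :
    ∑ k ∈ Finset.range N, B1 (x + k / N) = B1 (N * x) := by
  have hN' : (0 : ℝ) < N := by exact_mod_cast hN
  set h : ℝ → ℝ := fun x => ∑ k ∈ Finset.range N, B1 (x + k / N) with hh
  have hper : Function.Periodic h (1 / (N : ℝ)) := by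
    intro x
    have e1 := Finset.sum_range_succ (fun k : ℕ => B1 (x + k / N)) N
    have e2 := Finset.sum_range_succ' (fun k : ℕ => B1 (x + k / N)) N
    have e3 : B1 (x + (N : ℝ) / N) = B1 x := by
      rw [div_self hN'.ne']
      have := B1_add_int x 1
      simpa using this
    have e4 : h (x + 1 / N) = ∑ k ∈ Finset.range N, B1 (x + ((k + 1 : ℕ) : ℝ) / N) := by
      simp only [hh]
      refine Finset.sum_congr rfl fun k _ => ?_
      congr 1
      push_cast
      ring
    rw [e4]
    simp only [hh]
    rw [e1] at e2
    simp only [Nat.cast_zero, zero_div, add_zero] at e2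
    rw [e3] at e2
    linarith
  have hx : h x = h (x - (⌊N * x⌋ : ℤ) * (1 / (N : ℝ))) := (hper.sub_int_mul_eq _).symm
  have hy : x - (⌊N * x⌋ : ℤ) * (1 / (N : ℝ)) = Int.fract (N * x) / N := by
    unfold Int.fract; field_simp
  change h x = _
  rw [hx, hy]
  have hf0 := Int.fract_nonneg (N * x)
  have hf1 := Int.fract_lt_one (N * x)
  simp only [hh]
  have key : ∀ k ∈ Finset.range N, Int.fract (Int.fract (N * x) / N + k / N) =
      Int.fract (N * x) / N + k / N := by
    intro k hk
    rw [Int.fract_eq_self]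
    have hk' : (k : ℝ) + 1 ≤ N := by exact_mod_cast Finset.mem_range.1 hk
    constructor
    · positivity
    · rw [← add_div, div_lt_one hN']; linarith
  by_cases h0 : Int.fract (N * x) = 0
  · rw [B1, if_pos h0]
    obtain ⟨n, rfl⟩ : ∃ n, N = n + 1 := ⟨N - 1, by omega⟩
    rw [Finset.sum_range_succ']
    have hz : B1 (Int.fract (((n + 1 : ℕ) : ℝ) * x) / ((n + 1 : ℕ) : ℝ) + ((0 : ℕ) : ℝ) / ((n + 1 : ℕ) : ℝ)) = 0 := by
      rw [h0]; simp [B1]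
    rw [hz]
    have : ∀ k ∈ Finset.range n, B1 (Int.fract (((n + 1 : ℕ) : ℝ) * x) / ((n + 1 : ℕ) : ℝ) + ((k + 1 : ℕ) : ℝ) / ((n + 1 : ℕ) : ℝ)) = (k + 1) / (n + 1) - 1/2 := by
      intro k hk
      have := key (k + 1) (by simp at hk ⊢; omega)
      rw [B1, this, h0, if_neg]
      · push_cast; ring
      · push_cast; positivity
    rw [Finset.sum_congr rfl this, Finset.sum_sub_distrib, ← Finset.sum_div, Finset.sum_add_distrib, sum_range_cast_id]
    simp
    field_simp
    ring
  · have hpos : 0 < Int.fract (N * x) := lt_of_le_of_ne hf0 (Ne.symm h0)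
    have : ∀ k ∈ Finset.range N, B1 (Int.fract (N * x) / N + k / N) =
        Int.fract (N * x) / N + k / N - 1/2 := by
      intro k hk
      rw [B1, key k hk, if_neg]
      positivity
    rw [Finset.sum_congr rfl this, Finset.sum_sub_distrib, Finset.sum_add_distrib, ← Finset.sum_div, ← Finset.sum_div, sum_range_cast_id, B1, if_neg h0]
    simp
    field_simp
    ring

/-- sums over a full residue system modulo `M` in both coordinates -/
noncomputable def boxSum (M : ℕ) (G : ℤ → ℤ → ℂ) : ℂ :=
  ∑ x ∈ Finset.range M, ∑ y ∈ Finset.range M, G (x : ℤ) (y : ℤ)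

def Per (M : ℕ) (G : ℤ → ℤ → ℂ) : Prop :=
  ∀ x y x' y' : ℤ, (M : ℤ) ∣ x' - x → (M : ℤ) ∣ y' - y → G x' y' = G x y

lemma sum_range_zmod (M : ℕ) [NeZero M] (f : ℕ → ℂ) :
    ∑ x ∈ Finset.range M, f x = ∑ x : ZMod M, f x.val := by
  obtain ⟨n, rfl⟩ : ∃ n, M = n + 1 := ⟨M - 1, by have := NeZero.pos M; omega⟩
  rw [← Fin.sum_univ_eq_sum_range]
  rfl

lemma boxSum_zmod (M : ℕ) [NeZero M] (G : ℤ → ℤ → ℂ) :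
    boxSum M G = ∑ p : ZMod M × ZMod M, G (p.1.val : ℤ) (p.2.val : ℤ) := by
  unfold boxSum
  rw [Fintype.sum_prod_type, sum_range_zmod M (fun x => ∑ y ∈ Finset.range M, G (x : ℤ) (y : ℤ))]
  refine Finset.sum_congr rfl fun x _ => ?_
  rw [sum_range_zmod M (fun y => G (x.val : ℤ) (y : ℤ))]

lemma boxSum_equiv (M : ℕ) [NeZero M] (G : ℤ → ℤ → ℂ) (hG : Per M G) (g h : ℤ → ℤ → ℤ)
    (σ : ZMod M × ZMod M ≃ ZMod M × ZMod M)
    (hσ : ∀ x y : ℤ, σ ((x : ZMod M), (y : ZMod M)) = ((g x y : ZMod M), (h x y : ZMod M))) :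
    boxSum M (fun x y => G (g x y) (h x y)) = boxSum M G := by
  rw [boxSum_zmod, boxSum_zmod]
  refine Fintype.sum_equiv σ _ _ ?_
  rintro ⟨x, y⟩
  have h1 := hσ (x.val : ℤ) (y.val : ℤ)
  have h2 : ((x.val : ℤ) : ZMod M) = x := by simp
  have h3 : ((y.val : ℤ) : ZMod M) = y := by simp
  rw [h2, h3] at h1
  rw [h1]
  refine hG _ _ _ _ ?_ ?_
  · rw [← ZMod.intCast_eq_intCast_iff_dvd_sub]; simp
  · rw [← ZMod.intCast_eq_intCast_iff_dvd_sub]; simp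

lemma boxSum_translate (M : ℕ) [NeZero M] (G : ℤ → ℤ → ℂ) (hG : Per M G) (u v : ℤ) :
    boxSum M (fun x y => G (x + u) (y + v)) = boxSum M G :=
  boxSum_equiv M G hG (fun x _ => x + u) (fun _ y => y + v)
    (Equiv.addRight ((u : ZMod M), (v : ZMod M))) (by intro x y; simp)

lemma boxSum_linear (M : ℕ) [NeZero M] (G : ℤ → ℤ → ℂ) (hG : Per M G) (a b c d : ℤ)
    (hdet : a * d - b * c = 1) :
    boxSum M (fun x y => G (a * x + b * y) (c * x + d * y)) = boxSum M G := by
  have hd : (a : ZMod M) * d - b * c = 1 := by exact_mod_cast congrArg (Int.cast : ℤ → ZMod M) hdet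
  refine boxSum_equiv M G hG (fun x y => a * x + b * y) (fun x y => c * x + d * y)
    ⟨fun p => (a * p.1 + b * p.2, c * p.1 + d * p.2),
     fun p => (d * p.1 - b * p.2, -c * p.1 + a * p.2), ?_, ?_⟩ ?_
  · rintro ⟨x, y⟩
    ext
    · simp only; linear_combination x * hd
    · simp only; linear_combination y * hd
  · rintro ⟨x, y⟩
    ext
    · simp only; linear_combination x * hd
    · simp only; linear_combination y * hd
  · intro x y; simp

lemma boxSum_mul_left (M : ℕ) (z : ℂ) (G : ℤ → ℤ → ℂ) :
    boxSum M (fun x y => z * G x y) = z * boxSum M G := by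
  simp only [boxSum, Finset.mul_sum]

lemma boxSum_add (M : ℕ) (G H : ℤ → ℤ → ℂ) :
    boxSum M (fun x y => G x y + H x y) = boxSum M G + boxSum M H := by
  simp only [boxSum, Finset.sum_add_distrib]

lemma boxSum_sum (M N : ℕ) (G : ℕ → ℤ → ℤ → ℂ) :
    boxSum M (fun x y => ∑ k ∈ Finset.range N, G k x y) =
      ∑ k ∈ Finset.range N, boxSum M (G k) := by
  induction N with
  | zero => simp [boxSum]
  | succ n ih => simp only [Finset.sum_range_succ, boxSum_add, ih]

lemma boxSum_congr (M : ℕ) (G H : ℤ → ℤ → ℂ) (h : ∀ x y, G x y = H x y) :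
    boxSum M G = boxSum M H := by
  have : G = H := by funext x y; exact h x y
  rw [this]

/-- scaling -/
def sc (N : ℤ) (v : ℤ × ℤ) : ℤ × ℤ := (N * v.1, N * v.2)

/-- determinant -/
def dt (v w : ℤ × ℤ) : ℤ := v.1 * w.2 - v.2 * w.1

/-- lattice Dedekind sum -/
noncomputable def latD (M : ℕ) (F : ℤ → ℤ → ℂ) (v w : ℤ × ℤ) : ℂ :=
  (dt v w : ℂ) * boxSum M (fun x y => F x y *
    ((B1 ((dt (x, y) w : ℝ) / (dt v w : ℝ)) * B1 ((dt v (x, y) : ℝ) / (dt v w : ℝ)) : ℝ) : ℂ))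

lemma dt_neg (v w : ℤ × ℤ) : dt v w = - dt w v := by simp only [dt]; ring

lemma latD_swap (M : ℕ) (F : ℤ → ℤ → ℂ) (v w : ℤ × ℤ) : latD M F w v = - latD M F v w := by
  unfold latD
  rw [dt_neg w v, Int.cast_neg, neg_mul]
  congr 2
  refine boxSum_congr _ _ _ fun x y => ?_
  rw [dt_neg (x, y) v, dt_neg w (x, y)]
  push_cast
  rw [neg_div_neg_eq, neg_div_neg_eq]
  ring

lemma latD_negv (M : ℕ) (F : ℤ → ℤ → ℂ) (v w : ℤ × ℤ) : latD M F (-v) w = latD M F v w := by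
  unfold latD
  have h1 : ∀ u, dt (-v) u = - dt v u := by intro u; simp only [dt, Prod.fst_neg, Prod.snd_neg]; ring
  rw [h1 w, Int.cast_neg, neg_mul, ← mul_neg]
  congr 1
  rw [neg_eq_neg_one_mul, ← boxSum_mul_left]
  refine boxSum_congr _ _ _ fun x y => ?_
  rw [h1]
  push_cast
  rw [neg_div_neg_eq, div_neg, B1_neg]
  push_cast
  ring

lemma latD_scale_nat (M : ℕ) [NeZero M] (F : ℤ → ℤ → ℂ) (hF : Per M F) (v w : ℤ × ℤ)
    (hFv : ∀ x y k : ℤ, F (x + k * v.1) (y + k * v.2) = F x y) (N : ℕ) (hN : 0 < N)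
    (hM : (N : ℤ) * dt v w ∣ M) : latD M F (sc (N : ℤ) v) w = latD M F v w := by
  have h1 : ∀ u, dt (sc (N : ℤ) v) u = N * dt v u := by
    intro u; simp only [dt, sc]; ring
  have hNR : (N : ℝ) ≠ 0 := by exact_mod_cast hN.ne'
  by_cases h0 : dt v w = 0
  · simp [latD, h1, h0]
  have h0R : (dt v w : ℝ) ≠ 0 := by exact_mod_cast h0
  unfold latD
  rw [h1 w]
  set Δ := dt v w with hΔ
  set G : ℤ → ℤ → ℂ := fun x y => F x y * ((B1 ((dt (x, y) w : ℝ) / ((N * Δ : ℤ) : ℝ)) * B1 ((dt (sc (N : ℤ) v) (x, y) : ℝ) / ((N * Δ : ℤ) : ℝ)) : ℝ) : ℂ) with hG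
  have hper : Per M G := by
    intro x y x' y' hx hy
    simp only [hG]
    rw [hF x y x' y' hx hy]
    have hx' := hM.trans hx
    have hy' := hM.trans hy
    rw [B1_div_congr (k' := dt (x', y') w) (k := dt (x, y) w), B1_div_congr (k' := dt (sc (N : ℤ) v) (x', y')) (k := dt (sc (N : ℤ) v) (x, y))]
    · have : dt (sc (N : ℤ) v) (x', y') - dt (sc (N : ℤ) v) (x, y) = (sc (N : ℤ) v).1 * (y' - y) - (sc (N : ℤ) v).2 * (x' - x) := by
        simp only [dt]; ring
      rw [this]
      exact dvd_sub (hy'.mul_left _) (hx'.mul_left _)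
    · have : dt (x', y') w - dt (x, y) w = w.2 * (x' - x) - w.1 * (y' - y) := by
        simp only [dt]; ring
      rw [this]
      exact dvd_sub (hx'.mul_left _) (hy'.mul_left _)
  have hav : (N : ℂ) * boxSum M G = ∑ k ∈ Finset.range N, boxSum M (fun x y => G (x + (k : ℤ) * v.1) (y + (k : ℤ) * v.2)) := by
    rw [Finset.sum_congr rfl (fun (k : ℕ) _ => boxSum_translate M G hper ((k : ℤ) * v.1) ((k : ℤ) * v.2))]
    simp
  have : ((N * Δ : ℤ) : ℂ) * boxSum M G = (Δ : ℂ) * ((N : ℂ) * boxSum M G) := by push_cast; ring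
  rw [this, hav, ← boxSum_sum]
  congr 1
  refine boxSum_congr _ _ _ fun x y => ?_
  simp only [hG, hFv]
  rw [← Finset.mul_sum, ← Complex.ofReal_sum]
  congr 2
  have e1 : ∀ k : ℕ, (dt (x + (k : ℤ) * v.1, y + (k : ℤ) * v.2) w : ℝ) / ((N * Δ : ℤ) : ℝ) =
      (dt (x, y) w : ℝ) / ((N * Δ : ℤ) : ℝ) + k / N := by
    intro k
    have : dt (x + (k : ℤ) * v.1, y + (k : ℤ) * v.2) w = dt (x, y) w + k * Δ := by
      simp only [hΔ, dt]; ring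
    rw [this]; push_cast; field_simp
  have e2 : ∀ k : ℕ, (dt (sc (N : ℤ) v) (x + (k : ℤ) * v.1, y + (k : ℤ) * v.2) : ℝ) / ((N * Δ : ℤ) : ℝ) =
      (dt v (x, y) : ℝ) / Δ := by
    intro k
    rw [h1]
    have : dt v (x + (k : ℤ) * v.1, y + (k : ℤ) * v.2) = dt v (x, y) := by
      simp only [dt]; ring
    rw [this]; push_cast; field_simp
  simp only [e1, e2]
  rw [← Finset.sum_mul, B1_distrib N hN]
  congr 2
  push_cast; field_simp

lemma latD_scale (M : ℕ) [NeZero M] (F : ℤ → ℤ → ℂ) (hF : Per M F) (v w : ℤ × ℤ)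
    (hFv : ∀ x y k : ℤ, F (x + k * v.1) (y + k * v.2) = F x y) (N : ℤ) (hN : N ≠ 0)
    (hM : N * dt v w ∣ M) : latD M F (sc N v) w = latD M F v w := by
  obtain ⟨n, rfl | rfl⟩ := N.eq_nat_or_neg
  · exact latD_scale_nat M F hF v w hFv n (by omega) hM
  · have : sc (-(n : ℤ)) v = - sc n v := by ext <;> simp [sc]
    rw [this, latD_negv]
    exact latD_scale_nat M F hF v w hFv n (by omega) (by simpa using hM)

lemma latD_scale_right (M : ℕ) [NeZero M] (F : ℤ → ℤ → ℂ) (hF : Per M F) (v w : ℤ × ℤ)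
    (hFv : ∀ x y k : ℤ, F (x + k * w.1) (y + k * w.2) = F x y) (N : ℤ) (hN : N ≠ 0)
    (hM : N * dt v w ∣ M) : latD M F v (sc N w) = latD M F v w := by
  rw [latD_swap, latD_scale M F hF w v hFv N hN, latD_swap, neg_neg]
  rw [dt_neg]; simpa using hM


lemma latD_scaled (M : ℕ) [NeZero M] (F : ℤ → ℤ → ℂ) (hF : Per M F) (v w : ℤ × ℤ)
    (hFv : ∀ x y k : ℤ, F (x + k * v.1) (y + k * v.2) = F x y)
    (hFw : ∀ x y k : ℤ, F (x + k * w.1) (y + k * w.2) = F x y)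
    (a b c : ℤ) (ha : a ≠ 0) (hb : b ≠ 0) (hc : c ≠ 0) (hdt : dt v w = c)
    (hM : a * b * c ∣ M) :
    latD M F v w = -((a * b * c : ℤ) : ℂ) * boxSum M (fun x y => F x y *
      ((B1 ((dt v (x, y) : ℝ) / ((b * c : ℤ) : ℝ)) *
        B1 ((dt w (x, y) : ℝ) / ((c * a : ℤ) : ℝ)) : ℝ) : ℂ)) := by
  have haR : (a : ℝ) ≠ 0 := by exact_mod_cast ha
  have hbR : (b : ℝ) ≠ 0 := by exact_mod_cast hb
  have hcR : (c : ℝ) ≠ 0 := by exact_mod_cast hc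
  have h1 : latD M F (sc a v) w = latD M F v w := by
    refine latD_scale M F hF v w hFv a ha ?_
    rw [hdt]
    exact Dvd.dvd.trans ⟨b, by ring⟩ hM
  have hdt2 : dt (sc a v) w = a * c := by rw [← hdt]; simp only [dt, sc]; ring
  have h2 : latD M F (sc a v) (sc b w) = latD M F (sc a v) w := by
    refine latD_scale_right M F hF (sc a v) w hFw b hb ?_
    rw [hdt2]
    exact Dvd.dvd.trans ⟨1, by ring⟩ hM
  have hdt3 : dt (sc a v) (sc b w) = a * b * c := by rw [← hdt]; simp only [dt, sc]; ring
  rw [← h1, ← h2]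
  unfold latD
  rw [hdt3, neg_mul, ← mul_neg]
  congr 1
  rw [neg_eq_neg_one_mul, ← boxSum_mul_left]
  refine boxSum_congr _ _ _ fun x y => ?_
  have e1 : (dt (x, y) (sc b w) : ℝ) / ((a * b * c : ℤ) : ℝ) = -((dt w (x, y) : ℝ) / ((c * a : ℤ) : ℝ)) := by
    have : dt (x, y) (sc b w) = - (b * dt w (x, y)) := by simp only [dt, sc]; ring
    rw [this]; push_cast; field_simp
  have e2 : (dt (sc a v) (x, y) : ℝ) / ((a * b * c : ℤ) : ℝ) = (dt v (x, y) : ℝ) / ((b * c : ℤ) : ℝ) := by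
    have : dt (sc a v) (x, y) = a * dt v (x, y) := by simp only [dt, sc]; ring
    rw [this]; push_cast; field_simp
  rw [e1, e2, B1_neg]
  push_cast
  ring

lemma three_term (M : ℕ) [NeZero M] (F : ℤ → ℤ → ℂ) (hF : Per M F) (u v w : ℤ × ℤ)
    (hFu : ∀ x y k : ℤ, F (x + k * u.1) (y + k * u.2) = F x y)
    (hFv : ∀ x y k : ℤ, F (x + k * v.1) (y + k * v.2) = F x y)
    (hFw : ∀ x y k : ℤ, F (x + k * w.1) (y + k * w.2) = F x y)
    (h00 : F 0 0 = 0)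
    (hku : ∀ n : ℤ, n ∣ M → boxSum M (fun x y => F x y * (B2f ((dt u (x, y) : ℝ) / n) : ℂ)) = 0)
    (hkv : ∀ n : ℤ, n ∣ M → boxSum M (fun x y => F x y * (B2f ((dt v (x, y) : ℝ) / n) : ℂ)) = 0)
    (hkw : ∀ n : ℤ, n ∣ M → boxSum M (fun x y => F x y * (B2f ((dt w (x, y) : ℝ) / n) : ℂ)) = 0)
    (ha : dt v w ≠ 0) (hb : dt w u ≠ 0) (hc : dt u v ≠ 0)
    (hM : dt v w * dt w u * dt u v ∣ M) :
    latD M F u v + latD M F v w + latD M F w u = 0 := by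
  obtain ⟨a, haa⟩ : ∃ a, a = dt v w := ⟨_, rfl⟩
  obtain ⟨b, hbb⟩ : ∃ b, b = dt w u := ⟨_, rfl⟩
  obtain ⟨c, hcc⟩ : ∃ c, c = dt u v := ⟨_, rfl⟩
  rw [← haa, ← hbb, ← hcc] at hM
  rw [← haa] at ha
  rw [← hbb] at hb
  rw [← hcc] at hc
  have haR : (a : ℝ) ≠ 0 := by exact_mod_cast ha
  have hbR : (b : ℝ) ≠ 0 := by exact_mod_cast hb
  have hcR : (c : ℝ) ≠ 0 := by exact_mod_cast hc
  rw [latD_scaled M F hF u v hFu hFv a b c ha hb hc hcc.symm hM,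
    latD_scaled M F hF v w hFv hFw b c a hb hc ha haa.symm (Dvd.dvd.trans ⟨1, by ring⟩ hM),
    latD_scaled M F hF w u hFw hFu c a b hc ha hb hbb.symm (Dvd.dvd.trans ⟨1, by ring⟩ hM)]
  have r1 : b * c * a = a * b * c := by ring
  have r2 : c * a * b = a * b * c := by ring
  rw [r1, r2, ← mul_add, ← mul_add, ← boxSum_add, ← boxSum_add]
  have k1 := hku (b * c) (Dvd.dvd.trans ⟨a, by ring⟩ hM)
  have k2 := hkv (c * a) (Dvd.dvd.trans ⟨b, by ring⟩ hM)
  have k3 := hkw (a * b) (Dvd.dvd.trans ⟨c, by ring⟩ hM)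
  refine mul_eq_zero_of_right _ ?_
  have key : boxSum M (fun x y => (-(1/2) : ℂ) * ((F x y * (B2f ((dt u (x, y) : ℝ) / ((b * c : ℤ) : ℝ)) : ℂ)
      + F x y * (B2f ((dt v (x, y) : ℝ) / ((c * a : ℤ) : ℝ)) : ℂ))
      + F x y * (B2f ((dt w (x, y) : ℝ) / ((a * b : ℤ) : ℝ)) : ℂ))) = 0 := by
    rw [boxSum_mul_left, boxSum_add, boxSum_add, k1, k2, k3]; simp
  rw [← key]
  refine boxSum_congr _ _ _ fun x y => ?_
  have hs : (dt u (x, y) : ℝ) / ((b * c : ℤ) : ℝ) + (dt v (x, y) : ℝ) / ((c * a : ℤ) : ℝ)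
      + (dt w (x, y) : ℝ) / ((a * b : ℤ) : ℝ) = 0 := by
    have : a * dt u (x, y) + b * dt v (x, y) + c * dt w (x, y) = 0 := by
      rw [haa, hbb, hcc]; simp only [dt]; ring
    have h' : (a : ℝ) * dt u (x, y) + b * dt v (x, y) + c * dt w (x, y) = 0 := by exact_mod_cast this
    push_cast
    field_simp
    linarith
  by_cases hint : Int.fract ((dt u (x, y) : ℝ) / ((b * c : ℤ) : ℝ)) = 0 ∧
      Int.fract ((dt v (x, y) : ℝ) / ((c * a : ℤ) : ℝ)) = 0
  · have hF0 : F x y = 0 := by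
      obtain ⟨h1, h2⟩ := hint
      rw [Int.fract_eq_zero_iff] at h1 h2
      obtain ⟨m, hm⟩ := h1
      obtain ⟨n, hn⟩ := h2
      have hm' : dt u (x, y) = m * (b * c) := by
        have : (dt u (x, y) : ℝ) = m * (b * c) := by
          rw [hm]; push_cast; field_simp
        exact_mod_cast this
      have hn' : dt v (x, y) = n * (c * a) := by
        have : (dt v (x, y) : ℝ) = n * (c * a) := by
          rw [hn]; push_cast; field_simp
        exact_mod_cast this
      have hx : x = 0 + (-(n * a)) * u.1 + (m * b) * v.1 := by
        apply mul_left_cancel₀ hc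
        have : c * x = - dt v (x, y) * u.1 + dt u (x, y) * v.1 := by
          rw [hcc]; simp only [dt]; ring
        rw [this, hm', hn']; ring
      have hy : y = 0 + (-(n * a)) * u.2 + (m * b) * v.2 := by
        apply mul_left_cancel₀ hc
        have : c * y = - dt v (x, y) * u.2 + dt u (x, y) * v.2 := by
          rw [hcc]; simp only [dt]; ring
        rw [this, hm', hn']; ring
      rw [hx, hy, hFv, hFu, h00]
    simp [hF0]
  · have := B1_three _ _ _ hs hint
    rw [← mul_add, ← mul_add, ← mul_add, ← mul_add, ← Complex.ofReal_add, ← Complex.ofReal_add, this]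
    push_cast
    ring

lemma sc_eq_of_dt {u v w : ℤ × ℤ} (h : dt u v = 0) : sc (dt w u) v = sc (-dt v w) u := by
  have h' : u.1 * v.2 - u.2 * v.1 = 0 := h
  ext
  · simp only [sc, dt]; linear_combination -w.1 * h'
  · simp only [sc, dt]; linear_combination -w.2 * h'


lemma three_term_deg (M : ℕ) [NeZero M] (F : ℤ → ℤ → ℂ) (hF : Per M F) (u v w : ℤ × ℤ)
    (hFu : ∀ x y k : ℤ, F (x + k * u.1) (y + k * u.2) = F x y)
    (hFv : ∀ x y k : ℤ, F (x + k * v.1) (y + k * v.2) = F x y)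
    (hu : u ≠ 0) (hv : v ≠ 0)
    (hc : dt u v = 0) (hM : dt v w ≠ 0 → dt w u ≠ 0 → dt v w * dt w u ∣ M) :
    latD M F u v + latD M F v w + latD M F w u = 0 := by
  have h0 : latD M F u v = 0 := by simp [latD, hc]
  have hsc := sc_eq_of_dt (w := w) hc
  rw [h0, zero_add]
  by_cases ha : dt v w = 0
  · have hb : dt w u = 0 := by
      by_contra hb
      apply hv
      rw [ha] at hsc
      simp only [sc, Prod.mk.injEq, neg_zero, zero_mul, mul_eq_zero, hb, false_or] at hsc
      ext
      · exact hsc.1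
      · exact hsc.2
    simp [latD, ha, hb]
  · by_cases hb : dt w u = 0
    · exfalso
      apply hu
      rw [hb] at hsc
      simp only [sc, Prod.mk.injEq, zero_mul, zero_eq_mul, neg_eq_zero, ha, false_or] at hsc
      ext
      · exact hsc.1
      · exact hsc.2
    · have hM' := hM ha hb
      rw [← latD_scale M F hF v w hFv (dt w u) hb (by rwa [mul_comm] at hM'), hsc,
        latD_scale M F hF u w hFu _ (neg_ne_zero.2 ha), latD_swap M F w u]
      · ring
      · rw [dt_neg u w, neg_mul_neg]; exact hM'


noncomputable def Fch {q₁ q₂ : ℕ} (χ₁ : DirichletCharacter ℂ q₁)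
    (χ₂ : DirichletCharacter ℂ q₂) (x y : ℤ) : ℂ :=
  (starRingEnd ℂ) (χ₂ (y : ZMod q₂)) * (starRingEnd ℂ) (χ₁ (x : ZMod q₁))

lemma Fch_congr {q₁ q₂ : ℕ} (χ₁ : DirichletCharacter ℂ q₁) (χ₂ : DirichletCharacter ℂ q₂)
    (x y x' y' : ℤ) (hx : (q₁ : ℤ) ∣ x' - x) (hy : (q₂ : ℤ) ∣ y' - y) :
    Fch χ₁ χ₂ x' y' = Fch χ₁ χ₂ x y := by
  unfold Fch
  rw [← ZMod.intCast_eq_intCast_iff_dvd_sub] at hx hy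
  rw [hx, hy]

lemma Fch_per {q₁ q₂ : ℕ} (χ₁ : DirichletCharacter ℂ q₁) (χ₂ : DirichletCharacter ℂ q₂)
    (M : ℕ) (h1 : q₁ ∣ M) (h2 : q₂ ∣ M) : Per M (Fch χ₁ χ₂) := by
  intro x y x' y' hx hy
  exact Fch_congr χ₁ χ₂ x y x' y' ((Int.natCast_dvd_natCast.2 h1).trans hx)
    ((Int.natCast_dvd_natCast.2 h2).trans hy)

lemma Fch_act {q₁ q₂ : ℕ} (χ₁ : DirichletCharacter ℂ q₁) (χ₂ : DirichletCharacter ℂ q₂)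
    (a b c d x y : ℤ) (hc : (q₂ : ℤ) ∣ c) :
    Fch χ₁ χ₂ (a * x + (-(q₁ * b)) * y) (-c * x + d * y) = Fch χ₁ χ₂ a d * Fch χ₁ χ₂ x y := by
  rw [Fch_congr χ₁ χ₂ (a * x) (d * y) _ _ ⟨-b * y, by ring⟩
    ((hc.mul_right (-x)).trans ⟨1, by ring⟩)]
  unfold Fch
  push_cast
  simp only [map_mul]
  ring

lemma sum_range_periodic (f : ℕ → ℂ) (c : ℕ) (hf : ∀ i, f (i + c) = f i) (k : ℕ) :
    ∑ i ∈ Finset.range (c * k), f i = k * ∑ i ∈ Finset.range c, f i := by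
  have hf' : ∀ k i, f (c * k + i) = f i := by
    intro k
    induction k with
    | zero => intro i; simp
    | succ n ih => intro i; rw [← ih i, ← hf (c * n + i)]; congr 1; ring
  induction k with
  | zero => simp
  | succ n ih =>
    rw [mul_add, mul_one, Finset.sum_range_add, ih, Finset.sum_congr rfl fun i _ => hf' n i]
    push_cast; ring

lemma sum_char_zero {q : ℕ} (hq : 1 < q) (χ : DirichletCharacter ℂ q) (hχ : χ.IsPrimitive)
    (M : ℕ) (hM : q ∣ M) :
    ∑ x ∈ Finset.range M, (starRingEnd ℂ) (χ (((x : ℕ) : ℤ) : ZMod q)) = 0 := by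
  have : NeZero q := ⟨by omega⟩
  obtain ⟨k, rfl⟩ := hM
  have hne : χ ≠ 1 := by
    intro h
    have h2 : χ.conductor = q := hχ
    rw [h, DirichletCharacter.conductor_one] at h2
    omega
  rw [sum_range_periodic (fun x => (starRingEnd ℂ) (χ (((x : ℕ) : ℤ) : ZMod q)))]
  · rw [sum_range_zmod]
    have : ∑ x : ZMod q, (starRingEnd ℂ) (χ (((x.val : ℕ) : ℤ) : ZMod q)) = 0 := by
      rw [← map_sum]
      have : ∑ x : ZMod q, χ (((x.val : ℕ) : ℤ) : ZMod q) = ∑ x : ZMod q, χ x := by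
        refine Finset.sum_congr rfl fun x _ => ?_
        simp
      rw [this, MulChar.sum_eq_zero_of_ne_one hne, map_zero]
    rw [this, mul_zero]
  · intro i; simp

lemma kill {q₁ q₂ : ℕ} (hq₁ : 1 < q₁) (χ₁ : DirichletCharacter ℂ q₁)
    (χ₂ : DirichletCharacter ℂ q₂) (h₁ : χ₁.IsPrimitive) (M : ℕ) [NeZero M] (h1 : q₁ ∣ M)
    (h2 : q₂ ∣ M) (a b c d : ℤ) (hc : (q₂ : ℤ) ∣ c) (hdet : a * d - q₁ * b * c = 1)
    (n : ℤ) (hn : n ∣ M) :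
    boxSum M (fun x y => Fch χ₁ χ₂ x y *
      (B2f ((dt (q₁ * a, -(q₁ * c)) (x, y) : ℝ) / n) : ℂ)) = 0 := by
  have hper : Per M (fun x y => Fch χ₁ χ₂ x y *
      (B2f ((dt (q₁ * a, -(q₁ * c)) (x, y) : ℝ) / n) : ℂ)) := by
    intro x y x' y' hx hy
    simp only
    rw [Fch_per χ₁ χ₂ M h1 h2 x y x' y' hx hy, B2f_div_congr]
    have : dt (q₁ * a, -(q₁ * c)) (x', y') - dt (q₁ * a, -(q₁ * c)) (x, y) =
        (q₁ * a) * (y' - y) - (-(q₁ * c)) * (x' - x) := by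
      simp only [dt]; ring
    rw [this]
    exact dvd_sub ((hn.trans hy).mul_left _) ((hn.trans hx).mul_left _)
  rw [← boxSum_linear M _ hper a (-(q₁ * b)) (-c) d (by linarith)]
  have : ∀ x y : ℤ, Fch χ₁ χ₂ (a * x + (-(q₁ * b)) * y) (-c * x + d * y) *
      (B2f ((dt (q₁ * a, -(q₁ * c)) (a * x + (-(q₁ * b)) * y, -c * x + d * y) : ℝ) / n) : ℂ) =
      Fch χ₁ χ₂ a d * ((starRingEnd ℂ) (χ₁ (x : ZMod q₁)) *
        ((starRingEnd ℂ) (χ₂ (y : ZMod q₂)) * (B2f (((q₁ * y : ℤ) : ℝ) / n) : ℂ))) := by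
    intro x y
    have hd : dt (q₁ * a, -(q₁ * c)) (a * x + (-(q₁ * b)) * y, -c * x + d * y) = q₁ * y := by
      simp only [dt]
      linear_combination (q₁ * y : ℤ) * hdet
    rw [Fch_act χ₁ χ₂ a b c d x y hc, hd]
    unfold Fch
    ring
  rw [boxSum_congr _ _ _ this, boxSum_mul_left]
  refine mul_eq_zero_of_right _ ?_
  unfold boxSum
  simp_rw [← Finset.mul_sum]
  rw [← Finset.sum_mul, sum_char_zero hq₁ χ₁ h₁ M h1, zero_mul]

lemma latD_act {q₁ q₂ : ℕ} (χ₁ : DirichletCharacter ℂ q₁)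
    (χ₂ : DirichletCharacter ℂ q₂) (M : ℕ) [NeZero M] (h1 : q₁ ∣ M)
    (h2 : q₂ ∣ M) (a b c d : ℤ) (hc : (q₂ : ℤ) ∣ c) (hdet : a * d - q₁ * b * c = 1)
    (v w v' w' : ℤ × ℤ) (hv : v' = (a * v.1 + (-(q₁ * b)) * v.2, -c * v.1 + d * v.2))
    (hw : w' = (a * w.1 + (-(q₁ * b)) * w.2, -c * w.1 + d * w.2))
    (hM : dt v w = 0 ∨ dt v w ∣ M) :
    latD M (Fch χ₁ χ₂) v' w' = Fch χ₁ χ₂ a d * latD M (Fch χ₁ χ₂) v w := by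
  have hdt : dt v' w' = dt v w := by
    rw [hv, hw]; simp only [dt]
    linear_combination (v.1 * w.2 - v.2 * w.1) * hdet
  rcases hM with hM | hM
  · simp [latD, hdt, hM]
  unfold latD
  rw [hdt, mul_left_comm]
  congr 1
  rw [← boxSum_mul_left]
  set Δ := dt v w
  set G : ℤ → ℤ → ℂ := fun x y => Fch χ₁ χ₂ x y *
    ((B1 ((dt (x, y) w' : ℝ) / Δ) * B1 ((dt v' (x, y) : ℝ) / Δ) : ℝ) : ℂ) with hG
  have hper : Per M G := by
    intro x y x' y' hx hy
    simp only [hG]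
    rw [Fch_per χ₁ χ₂ M h1 h2 x y x' y' hx hy, B1_div_congr (k' := dt (x', y') w') (k := dt (x, y) w'), B1_div_congr (k' := dt v' (x', y')) (k := dt v' (x, y))]
    · have : dt v' (x', y') - dt v' (x, y) = v'.1 * (y' - y) - v'.2 * (x' - x) := by
        simp only [dt]; ring
      rw [this]
      exact dvd_sub ((hM.trans hy).mul_left _) ((hM.trans hx).mul_left _)
    · have : dt (x', y') w' - dt (x, y) w' = w'.2 * (x' - x) - w'.1 * (y' - y) := by
        simp only [dt]; ring
      rw [this]
      exact dvd_sub ((hM.trans hx).mul_left _) ((hM.trans hy).mul_left _)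
  rw [← boxSum_linear M G hper a (-(q₁ * b)) (-c) d (by linarith)]
  refine boxSum_congr _ _ _ fun x y => ?_
  simp only [hG]
  have e1 : dt (a * x + (-(q₁ * b)) * y, -c * x + d * y) w' = dt (x, y) w := by
    rw [hw]; simp only [dt]
    linear_combination (x * w.2 - y * w.1) * hdet
  have e2 : dt v' (a * x + (-(q₁ * b)) * y, -c * x + d * y) = dt v (x, y) := by
    rw [hv]; simp only [dt]
    linear_combination (v.1 * y - v.2 * x) * hdet
  rw [e1, e2, Fch_act χ₁ χ₂ a b c d x y hc, mul_assoc]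

lemma latD_ded {q₁ q₂ : ℕ} (hq₁ : 1 < q₁) (χ₁ : DirichletCharacter ℂ q₁)
    (χ₂ : DirichletCharacter ℂ q₂) (M : ℕ) (a c : ℤ) (hc : 0 < c) (hqc : (q₂ : ℤ) ∣ c)
    (h1 : q₁ ∣ M) (hM : c ∣ M) :
    latD M (Fch χ₁ χ₂) (q₁, 0) (q₁ * a, -c) = (M : ℂ) ^ 2 * ded χ₁ χ₂ a c := by
  obtain ⟨n, rfl⟩ : ∃ n : ℕ, c = n := ⟨c.toNat, by omega⟩
  have hn : 0 < n := by omega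
  have hM' : n ∣ M := by exact_mod_cast hM
  have hqR : (q₁ : ℝ) ≠ 0 := by positivity
  have hnR : (n : ℝ) ≠ 0 := by positivity
  have hqC : (q₁ : ℂ) ≠ 0 := by exact_mod_cast (by omega : q₁ ≠ 0)
  have hnC : (n : ℂ) ≠ 0 := by exact_mod_cast hn.ne'
  obtain ⟨k1, hk1⟩ := h1
  obtain ⟨k2, hk2⟩ := hM'
  set g : ℕ → ℕ → ℂ := fun m j => (starRingEnd ℂ) (χ₂ (j : ZMod q₂)) * (starRingEnd ℂ) (χ₁ (m : ZMod q₁)) *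
      ((B1 ((j : ℝ) / (n : ℝ)) * B1 ((m : ℝ) / (q₁ : ℝ) + (a : ℝ) * (j : ℝ) / (n : ℝ)) : ℝ) : ℂ) with hg
  have hded : ded χ₁ χ₂ a n = ∑ j ∈ Finset.range n, ∑ m ∈ Finset.range q₁, g m j := by
    unfold ded
    simp [hg]
  have hg1 : ∀ j m, g (m + q₁) j = g m j := by
    intro j m
    simp only [hg]
    have : ((m + q₁ : ℕ) : ℝ) / q₁ + a * j / n = (m : ℝ) / q₁ + a * j / n + ((1 : ℤ) : ℝ) := by
      push_cast; field_simp; ring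
    rw [this, B1_add_int]
    simp
  have hg2 : ∀ m j, g m (j + n) = g m j := by
    intro m j
    simp only [hg]
    have e1 : (m : ℝ) / q₁ + a * ((j + n : ℕ) : ℝ) / n = (m : ℝ) / q₁ + a * j / n + (a : ℝ) := by
      push_cast; field_simp; ring
    have e2 : ((j + n : ℕ) : ℝ) / n = (j : ℝ) / n + ((1 : ℤ) : ℝ) := by
      push_cast; field_simp
    have e3 : ((j + n : ℕ) : ZMod q₂) = j := by
      have : ((n : ℕ) : ZMod q₂) = 0 := by
        rw [ZMod.natCast_eq_zero_iff]; exact_mod_cast hqc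
      push_cast; rw [this, add_zero]
    rw [e1, e2, e3, B1_add_int, B1_add_int]
  have hdt : dt ((q₁ : ℤ), 0) (q₁ * a, -(n : ℤ)) = -(q₁ * n) := by simp [dt]
  unfold latD
  rw [hdt]
  have key : ∀ x y : ℕ, Fch χ₁ χ₂ (x : ℤ) (y : ℤ) * ((B1 ((dt ((x : ℤ), (y : ℤ)) (q₁ * a, -(n : ℤ)) : ℝ) / ((-(q₁ * n) : ℤ) : ℝ)) *
      B1 ((dt ((q₁ : ℤ), 0) ((x : ℤ), (y : ℤ)) : ℝ) / ((-(q₁ * n) : ℤ) : ℝ)) : ℝ) : ℂ) = - g x y := by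
    intro x y
    have e1 : (dt ((x : ℤ), (y : ℤ)) (q₁ * a, -(n : ℤ)) : ℝ) / ((-(q₁ * n) : ℤ) : ℝ) = (x : ℝ) / q₁ + a * y / n := by
      simp only [dt]; push_cast; field_simp; ring
    have e2 : (dt ((q₁ : ℤ), 0) ((x : ℤ), (y : ℤ)) : ℝ) / ((-(q₁ * n) : ℤ) : ℝ) = -((y : ℝ) / n) := by
      simp only [dt]; push_cast; field_simp; ring
    rw [e1, e2, B1_neg]
    simp only [hg, Fch]
    push_cast
    ring
  have hbox : boxSum M (fun x y => Fch χ₁ χ₂ x y * ((B1 ((dt (x, y) (q₁ * a, -(n : ℤ)) : ℝ) / ((-(q₁ * n) : ℤ) : ℝ)) *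
      B1 ((dt ((q₁ : ℤ), 0) (x, y) : ℝ) / ((-(q₁ * n) : ℤ) : ℝ)) : ℝ) : ℂ)) = -((k1 : ℂ) * k2 * ded χ₁ χ₂ a n) := by
    unfold boxSum
    simp_rw [key]
    simp only [Finset.sum_neg_distrib]
    congr 1
    rw [Finset.sum_comm, hded]
    have s1 : ∀ j, ∑ m ∈ Finset.range M, g m j = k1 * ∑ m ∈ Finset.range q₁, g m j := by
      intro j
      rw [hk1]
      exact sum_range_periodic (fun m => g m j) q₁ (hg1 j) k1
    simp_rw [s1]
    rw [← Finset.mul_sum, hk2, sum_range_periodic (fun j => ∑ m ∈ Finset.range q₁, g m j) n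
      (fun j => Finset.sum_congr rfl fun m _ => hg2 m j) k2]
    ring
  rw [hbox]
  have hM2 : (M : ℂ) ^ 2 = (q₁ * k1) * (n * k2) := by
    rw [sq]
    nth_rewrite 1 [hk1]
    rw [hk2]
    push_cast; ring
  rw [hM2]
  push_cast
  ring

lemma char_conj {q : ℕ} (χ : DirichletCharacter ℂ q) (a d : ℤ)
    (h : (a : ZMod q) * (d : ZMod q) = 1) : (starRingEnd ℂ) (χ (a : ZMod q)) = χ (d : ZMod q) := by
  have hu : IsUnit (a : ZMod q) := IsUnit.of_mul_eq_one _ h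
  have hn : ‖χ (a : ZMod q)‖ = 1 := by
    have := χ.unit_norm_eq_one hu.unit
    simpa using this
  have h1 : χ (a : ZMod q) * χ (d : ZMod q) = 1 := by rw [← map_mul, h, map_one]
  have h2 : (starRingEnd ℂ) (χ (a : ZMod q)) * χ (a : ZMod q) = 1 := by
    rw [mul_comm, Complex.mul_conj, Complex.normSq_eq_norm_sq, hn]; simp
  calc (starRingEnd ℂ) (χ (a : ZMod q)) = (starRingEnd ℂ) (χ (a : ZMod q)) * (χ (a : ZMod q) * χ (d : ZMod q)) := by rw [h1, mul_one]
    _ = _ := by rw [← mul_assoc, h2, one_mul]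

lemma psi_eq {q₁ q₂ : ℕ} (χ₁ : DirichletCharacter ℂ q₁)
    (χ₂ : DirichletCharacter ℂ q₂) (a b c d : ℤ) (hdet : a * d - q₁ * b * c = 1) (hc : (q₂ : ℤ) ∣ c) :
    psiChar χ₁ χ₂ (d : ZMod (q₁ * q₂)) = Fch χ₁ χ₂ a d := by
  have hu : IsCoprime d ((q₁ * q₂ : ℕ) : ℤ) := by
    obtain ⟨e, rfl⟩ := hc
    exact ⟨a, -(b * e), by push_cast; linarith⟩
  have hd1 : (a : ZMod q₁) * (d : ZMod q₁) = 1 := by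
    have := congrArg (Int.cast : ℤ → ZMod q₁) hdet
    push_cast at this
    simpa using this
  unfold psiChar Fch
  rw [MulChar.mul_apply, DirichletCharacter.changeLevel_eq_cast_of_dvd' _ _ hu, DirichletCharacter.changeLevel_eq_cast_of_dvd' _ _ hu, char_conj χ₁ a d hd1]
  rw [mul_comm]
  rfl

lemma exists_M (q₁ q₂ : ℕ) (h1 : q₁ ≠ 0) (h2 : q₂ ≠ 0) (A B C : ℤ) :
    ∃ M : ℕ, M ≠ 0 ∧ q₁ ∣ M ∧ q₂ ∣ M ∧ (A ≠ 0 → A ∣ M) ∧ (B ≠ 0 → B ∣ M) ∧ (C ≠ 0 → C ∣ M) ∧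
      (A ≠ 0 → B ≠ 0 → A * B ∣ M) ∧ (B ≠ 0 → C ≠ 0 → B * C ∣ M) ∧ (C ≠ 0 → A ≠ 0 → C * A ∣ M) ∧
      (A ≠ 0 → B ≠ 0 → C ≠ 0 → A * B * C ∣ M) := by
  have aux : ∀ A : ℤ, ∃ n : ℕ, n ≠ 0 ∧ (A ≠ 0 → A ∣ (n : ℤ)) := by
    intro A
    by_cases h : A = 0
    · exact ⟨1, one_ne_zero, fun h' => absurd h h'⟩
    · exact ⟨A.natAbs, by simpa using h, fun _ => Int.dvd_natAbs.2 dvd_rfl⟩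
  obtain ⟨a, ha0, ha⟩ := aux A
  obtain ⟨b, hb0, hb⟩ := aux B
  obtain ⟨c, hc0, hc⟩ := aux C
  refine ⟨q₁ * q₂ * (a * b * c), by positivity, ⟨q₂ * (a * b * c), by ring⟩,
    ⟨q₁ * (a * b * c), by ring⟩, ?_, ?_, ?_, ?_, ?_, ?_, ?_⟩
  · intro h; exact (ha h).trans ⟨q₁ * q₂ * (b * c), by push_cast; ring⟩
  · intro h; exact (hb h).trans ⟨q₁ * q₂ * (a * c), by push_cast; ring⟩
  · intro h; exact (hc h).trans ⟨q₁ * q₂ * (a * b), by push_cast; ring⟩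
  · intro h h'; exact (mul_dvd_mul (ha h) (hb h')).trans ⟨q₁ * q₂ * c, by push_cast; ring⟩
  · intro h h'; exact (mul_dvd_mul (hb h) (hc h')).trans ⟨q₁ * q₂ * a, by push_cast; ring⟩
  · intro h h'; exact (mul_dvd_mul (hc h) (ha h')).trans ⟨q₁ * q₂ * b, by push_cast; ring⟩
  · intro h h' h''
    exact (mul_dvd_mul (mul_dvd_mul (ha h) (hb h')) (hc h'')).trans
      ⟨q₁ * q₂, by push_cast; ring⟩

lemma gamma_data {q₁ q₂ : ℕ} (γ : SL(2, ℤ)) (hγ : γ ∈ Gamma0 (q₁ * q₂)) :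
    ∃ c : ℤ, (γ : Matrix (Fin 2) (Fin 2) ℤ) 1 0 = q₁ * c ∧ (q₂ : ℤ) ∣ c ∧
      γ 0 0 * γ 1 1 - q₁ * γ 0 1 * c = 1 := by
  rw [Gamma0_mem, ZMod.intCast_zmod_eq_zero_iff_dvd] at hγ
  obtain ⟨e, he⟩ := hγ
  refine ⟨q₂ * e, ?_, ⟨e, rfl⟩, ?_⟩
  · rw [he]; push_cast; ring
  · have := γ.det_coe
    rw [Matrix.det_fin_two, he] at this
    push_cast at this
    linarith

lemma dedSL_lat {q₁ q₂ : ℕ} (hq₁ : 1 < q₁) (χ₁ : DirichletCharacter ℂ q₁)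
    (χ₂ : DirichletCharacter ℂ q₂) (γ : SL(2, ℤ)) (c : ℤ)
    (hc : (γ : Matrix (Fin 2) (Fin 2) ℤ) 1 0 = q₁ * c) (hqc : (q₂ : ℤ) ∣ c) (M : ℕ) (hqM : q₁ ∣ M)
    (hM : dt ((q₁ : ℤ), 0) (q₁ * γ 0 0, -(q₁ * c)) ≠ 0 →
      dt ((q₁ : ℤ), 0) (q₁ * γ 0 0, -(q₁ * c)) ∣ M) :
    latD M (Fch χ₁ χ₂) ((q₁ : ℤ), 0) (q₁ * γ 0 0, -(q₁ * c)) = (M : ℂ) ^ 2 * dedSL χ₁ χ₂ γ := by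
  have hdt : dt ((q₁ : ℤ), 0) (q₁ * γ 0 0, -(q₁ * c)) = -(q₁ * (q₁ * c)) := by simp [dt]
  have hq : (q₁ : ℤ) ≠ 0 := by omega
  rw [hdt, neg_ne_zero, neg_dvd] at hM
  have hM' : q₁ * c ≠ 0 → q₁ * c ∣ (M : ℤ) := fun h =>
    (dvd_mul_left _ _).trans (hM (mul_ne_zero hq h))
  unfold dedSL
  rw [hc]
  split_ifs with hp hn
  · exact latD_ded hq₁ χ₁ χ₂ M _ _ hp (hqc.mul_left _) hqM (hM' hp.ne')
  · rw [← latD_ded hq₁ χ₁ χ₂ M _ _ (by omega) ((hqc.mul_left _).neg_right) hqM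
      (by rw [neg_dvd]; exact hM' hn.ne)]
    have : ((q₁ * -(γ 0 0), -(-(q₁ * c))) : ℤ × ℤ) = -(q₁ * γ 0 0, -(q₁ * c)) := by
      ext <;> simp
    rw [this, latD_swap, latD_swap M _ (-_), latD_negv]
  · have : (q₁ : ℤ) * c = 0 := by omega
    unfold latD
    rw [hdt, this]
    simp

/-- Crossed homomorphism identity:
`S_{χ₁,χ₂}(γ₁γ₂) = S_{χ₁,χ₂}(γ₁) + ψ(γ₁) S_{χ₁,χ₂}(γ₂)` for `γ₁, γ₂ ∈ Γ₀(q₁q₂)`. -/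
theorem crossed_homomorphism {q₁ q₂ : ℕ} (hq₁ : 1 < q₁) (hq₂ : 1 < q₂)
    (χ₁ : DirichletCharacter ℂ q₁) (χ₂ : DirichletCharacter ℂ q₂)
    (h₁ : χ₁.IsPrimitive) (h₂ : χ₂.IsPrimitive)
    (hpar : χ₁ (-1) * χ₂ (-1) = 1)
    (γ₁ γ₂ : SL(2, ℤ)) (hγ₁ : γ₁ ∈ Gamma0 (q₁ * q₂)) (hγ₂ : γ₂ ∈ Gamma0 (q₁ * q₂)) :
    dedSL χ₁ χ₂ (γ₁ * γ₂) = dedSL χ₁ χ₂ γ₁ +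
      psiChar χ₁ χ₂ (((γ₁ : Matrix (Fin 2) (Fin 2) ℤ) 1 1 : ZMod (q₁ * q₂))) *
        dedSL χ₁ χ₂ γ₂ := by 
  have hq1pos : 0 < q₁ := by omega
  have hq2pos : 0 < q₂ := by omega
  obtain ⟨c₁, hc₁, hqc₁, hdet₁⟩ := gamma_data γ₁ hγ₁
  obtain ⟨c₂, hc₂, hqc₂, hdet₂⟩ := gamma_data γ₂ hγ₂
  obtain ⟨c₃, hc₃, hqc₃, hdet₃⟩ := gamma_data (γ₁ * γ₂) (mul_mem hγ₁ hγ₂)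
  have hm00 : ((γ₁ * γ₂ : SL(2, ℤ)) : Matrix (Fin 2) (Fin 2) ℤ) 0 0 = γ₁ 0 0 * γ₂ 0 0 + γ₁ 0 1 * γ₂ 1 0 := by
    simp [Matrix.mul_apply, Fin.sum_univ_two]
  have hm10 : ((γ₁ * γ₂ : SL(2, ℤ)) : Matrix (Fin 2) (Fin 2) ℤ) 1 0 = γ₁ 1 0 * γ₂ 0 0 + γ₁ 1 1 * γ₂ 1 0 := by
    simp [Matrix.mul_apply, Fin.sum_univ_two]
  obtain ⟨u, hu⟩ : ∃ u : ℤ × ℤ, u = ((q₁ : ℤ), 0) := ⟨_, rfl⟩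
  obtain ⟨v, hv⟩ : ∃ v : ℤ × ℤ, v = (q₁ * γ₁ 0 0, -(q₁ * c₁)) := ⟨_, rfl⟩
  obtain ⟨v₂, hv₂⟩ : ∃ v : ℤ × ℤ, v = (q₁ * γ₂ 0 0, -(q₁ * c₂)) := ⟨_, rfl⟩
  obtain ⟨w, hw⟩ : ∃ v : ℤ × ℤ, v = (q₁ * (γ₁ * γ₂) 0 0, -(q₁ * c₃)) := ⟨_, rfl⟩
  obtain ⟨M, hMpos, hqM, hq2M, hA, hB, hC, hAB, hBC, hCA, hABC⟩ := exists_M q₁ q₂ (by omega) (by omega) (dt v w) (dt w u) (dt u v)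
  have : NeZero M := ⟨hMpos⟩
  have hMC : (M : ℂ) ^ 2 ≠ 0 := pow_ne_zero _ (by exact_mod_cast hMpos)
  have hv' : v = (γ₁ 0 0 * u.1 + (-(q₁ * γ₁ 0 1)) * u.2, -c₁ * u.1 + γ₁ 1 1 * u.2) := by
    rw [hv, hu]; ext <;> simp only <;> ring
  have hw' : w = (γ₁ 0 0 * v₂.1 + (-(q₁ * γ₁ 0 1)) * v₂.2, -c₁ * v₂.1 + γ₁ 1 1 * v₂.2) := by
    rw [hw, hv₂]
    ext
    · simp only; rw [hm00, hc₂]; ring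
    · simp only; rw [← hc₃, hm10, hc₁, hc₂]; ring
  have hdt2 : dt v w = dt u v₂ := by
    rw [hv', hw']; simp only [dt]
    linear_combination (u.1 * v₂.2 - u.2 * v₂.1) * hdet₁
  have d1 := dedSL_lat hq₁ χ₁ χ₂ γ₁ c₁ hc₁ hqc₁ M hqM (fun h => by
    rw [← hu, ← hv] at h ⊢; exact hC h)
  have d2 := dedSL_lat hq₁ χ₁ χ₂ γ₂ c₂ hc₂ hqc₂ M hqM (fun h => by
    rw [← hu, ← hv₂, ← hdt2] at h ⊢; exact hA h)
  have d3 := dedSL_lat hq₁ χ₁ χ₂ (γ₁ * γ₂) c₃ hc₃ hqc₃ M hqM (fun h => by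
    rw [← hu, ← hw, dt_neg, neg_ne_zero] at h
    rw [← hu, ← hw, dt_neg, neg_dvd]; exact hB h)
  rw [← hu, ← hv] at d1
  rw [← hu, ← hv₂] at d2
  rw [← hu, ← hw] at d3
  have hF := Fch_per χ₁ χ₂ M hqM hq2M
  have hFv : ∀ a c : ℤ, (q₂ : ℤ) ∣ c → ∀ x y k : ℤ,
      Fch χ₁ χ₂ (x + k * (q₁ * a)) (y + k * (-(q₁ * c))) = Fch χ₁ χ₂ x y := by
    intro a c hc x y k
    exact Fch_congr χ₁ χ₂ _ _ _ _ ⟨k * a, by ring⟩ ((hc.mul_right (-k * q₁)).trans ⟨1, by ring⟩)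
  have hu2 : u = ((q₁ : ℤ) * 1, -((q₁ : ℤ) * 0)) := by rw [hu]; simp
  have hFu' : ∀ x y k : ℤ, Fch χ₁ χ₂ (x + k * u.1) (y + k * u.2) = Fch χ₁ χ₂ x y := by
    rw [hu2]; exact hFv _ _ (dvd_zero _)
  have hFv' : ∀ x y k : ℤ, Fch χ₁ χ₂ (x + k * v.1) (y + k * v.2) = Fch χ₁ χ₂ x y := by
    rw [hv]; exact hFv _ _ hqc₁
  have hFw' : ∀ x y k : ℤ, Fch χ₁ χ₂ (x + k * w.1) (y + k * w.2) = Fch χ₁ χ₂ x y := by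
    rw [hw]; exact hFv _ _ hqc₃
  have hu0 : u ≠ 0 := by
    rw [hu]; intro h
    have := congrArg Prod.fst h
    simp at this; omega
  have hne : ∀ a b c d : ℤ, a * d - q₁ * b * c = 1 → ((q₁ * a, -(q₁ * c)) : ℤ × ℤ) ≠ 0 := by
    intro a b c d hd h
    have e1 := congrArg Prod.fst h
    have e2 := congrArg Prod.snd h
    have : q₁ ≠ 0 := by omega
    simp [this] at e1 e2
    rw [e1, e2] at hd
    simp at hd
  have hv0 : v ≠ 0 := by rw [hv]; exact hne _ _ _ _ hdet₁
  have hw0 : w ≠ 0 := by rw [hw]; exact hne _ _ _ _ hdet₃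
  have three : latD M (Fch χ₁ χ₂) u v + latD M (Fch χ₁ χ₂) v w + latD M (Fch χ₁ χ₂) w u = 0 := by
    by_cases hc : dt u v = 0
    · exact three_term_deg M _ hF u v w hFu' hFv' hu0 hv0 hc hAB
    by_cases ha : dt v w = 0
    · have := three_term_deg M _ hF v w u hFv' hFw' hv0 hw0 ha hBC
      linear_combination this
    by_cases hb : dt w u = 0
    · have := three_term_deg M _ hF w u v hFw' hFu' hw0 hu0 hb hCA
      linear_combination this
    refine three_term M _ hF u v w hFu' hFv' hFw' ?_ ?_ ?_ ?_ ha hb hc (hABC ha hb hc)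
    · have hnt : Nontrivial (ZMod q₁) := ZMod.nontrivial_iff.2 (by omega)
      simp [Fch, MulChar.map_zero χ₁]
    · rw [hu2]
      exact kill hq₁ χ₁ χ₂ h₁ M hqM hq2M 1 0 0 1 (dvd_zero _) (by ring)
    · rw [hv]
      exact kill hq₁ χ₁ χ₂ h₁ M hqM hq2M _ _ _ _ hqc₁ hdet₁
    · rw [hw]
      exact kill hq₁ χ₁ χ₂ h₁ M hqM hq2M _ _ _ _ hqc₃ hdet₃
  have hact : latD M (Fch χ₁ χ₂) v w = Fch χ₁ χ₂ (γ₁ 0 0) (γ₁ 1 1) * latD M (Fch χ₁ χ₂) u v₂ := by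
    refine latD_act χ₁ χ₂ M hqM hq2M _ _ _ _ hqc₁ hdet₁ u v₂ v w hv' hw' ?_
    rw [← hdt2]
    by_cases h : dt v w = 0
    · exact Or.inl h
    · exact Or.inr (hA h)
  rw [psi_eq χ₁ χ₂ _ _ _ _ hdet₁ hqc₁]
  rw [hact, latD_swap M _ u w, d1, d2, d3] at three
  apply mul_left_cancel₀ hMC
  linear_combination -three
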